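/- Let R be a ring and S a class of strongly finitely presented right R-modules containing the free module R and closed under direct summands, extensions, and kernels of epimorphisms. Put B = S^{⊥₁}, C = lim→ S, and D = C^{⊥₁}. Then for any short exact sequence of right R-modules 0 → M → L → M → 0 with L ∈ D and M ∈ B, one has M ∈ D; in other words, any D-periodic module belonging to B actually belongs to D. -/

import Mathlib

open CategoryTheory CategoryTheory.Limits

universe w v u

namespace GenPeriodicity

variable {K : Type u} [Category.{v} K]

section AbelianDefs

variable [Abelian K]

/-- `Ext¹(X, Y) = 0`, expressed by the splitting of all short exact sequences
`0 → Y → E → X → 0`. -/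
def Ext1Zero (X Y : K) : Prop :=
  ∀ (E : K) (i : Y ⟶ E) (p : E ⟶ X) (w : i ≫ p = 0),
    (ShortComplex.mk i p w).ShortExact → ∃ s : X ⟶ E, s ≫ p = 𝟙 X

/-- The right `Ext¹`-orthogonal class `S^{⊥₁}`. -/
def rightPerp (S : Set K) : Set K := {B | ∀ X ∈ S, Ext1Zero X B}

/-- The left `Ext¹`-orthogonal class `^{⊥₁}B`. -/
def leftPerp (B : Set K) : Set K := {A | ∀ Y ∈ B, Ext1Zero A Y}

/-- A class of objects is closed under extensions. -/
def ClosedUnderExtensions (C : Set K) : Prop :=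
  ∀ (X : ShortComplex K), X.ShortExact → X.X₁ ∈ C → X.X₃ ∈ C → X.X₂ ∈ C

/-- A class of objects is closed under kernels of epimorphisms. -/
def ClosedUnderKernelsOfEpis (C : Set K) : Prop :=
  ∀ (X : ShortComplex K), X.ShortExact → X.X₂ ∈ C → X.X₃ ∈ C → X.X₁ ∈ C

/-- A class of objects is closed under direct summands (retracts). -/
def ClosedUnderDirectSummands (C : Set K) : Prop :=
  ∀ X ∈ C, ∀ (Y : K) (s : Y ⟶ X) (r : X ⟶ Y), s ≫ r = 𝟙 Y → Y ∈ C

/-- A (doubly unbounded) complex is acyclic if it is exact at every term. -/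
def IsAcyclic (X : CochainComplex K ℤ) : Prop := ∀ n : ℤ, X.ExactAt n

end AbelianDefs

/-- Data exhibiting `M` as a direct limit (over a directed poset) of objects from `S`. -/
structure DirectSystemTo (S : Set K) (M : K) where
  I : Type v
  [po : PartialOrder I]
  dir : IsDirected I (· ≤ ·)
  ne : Nonempty I
  F : I ⥤ K
  mem : ∀ i, F.obj i ∈ S
  c : Cocone F
  hc : IsColimit c
  iso : c.pt ≅ M

/-- `lim→ S`: the class of all direct limits of direct systems of objects of `S`
indexed by directed posets. -/
def limClosure (S : Set K) : Set K := {M | Nonempty (DirectSystemTo S M)}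

/-- A class of objects is closed under direct limits (indexed by directed posets). -/
def ClosedUnderDirectLimits (C : Set K) : Prop :=
  ∀ (I : Type v) [PartialOrder I], IsDirected I (· ≤ ·) → Nonempty I →
    ∀ (F : I ⥤ K), (∀ i, F.obj i ∈ C) → ∀ (c : Cocone F), IsColimit c → c.pt ∈ C

/-- A class of objects is closed under (set-indexed) coproducts. -/
def ClosedUnderCoproducts (C : Set K) : Prop :=
  ∀ (B : Type v) (X : B → K), (∀ b, X b ∈ C) → ∀ (c : Cofan X), IsColimit c → c.pt ∈ C

/-- A right `R`-module (as a left `Rᵐᵒᵖ`-module) is strongly finitely presented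
(of type `FP_∞`) if it admits a resolution by finitely generated projective modules. -/
def StronglyFinitelyPresented {R : Type u} [Ring R] (M : ModuleCat.{u} Rᵐᵒᵖ) : Prop :=
  ∃ (P : ℕ → ModuleCat.{u} Rᵐᵒᵖ) (d : ∀ n, P (n + 1) ⟶ P n) (ε : P 0 ⟶ M)
    (w0 : d 0 ≫ ε = 0) (w : ∀ n, d (n + 1) ≫ d n = 0),
    (∀ n, Projective (P n)) ∧ (∀ n, Module.Finite Rᵐᵒᵖ (P n)) ∧ Epi ε ∧
    (ShortComplex.mk (d 0) ε w0).Exact ∧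
    (∀ n, (ShortComplex.mk (d (n + 1)) (d n) (w n)).Exact)

section Cocycles

variable {Λ : Type*} [Ring Λ] {P : Type*} [Preorder P]
  {G : P → Type*} [∀ i, AddCommGroup (G i)] [∀ i, Module Λ (G i)]
  (g : ∀ i j, i ≤ j → G i →ₗ[Λ] G j)
  {N : Type*} [AddCommGroup N] [Module Λ N]

/-- A `1`-cochain on a directed system with values in `N` that satisfies the cocycle identity
on the (lower) set of indices `s`. -/
def IsCocycleOn (s : Set P) (c : ∀ i, P → (G i →ₗ[Λ] N)) : Prop :=
  ∀ i j k (hij : i ≤ j), j ≤ k → k ∈ s → ∀ x, c i k x = c i j x + c j k (g i j hij x)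

/-- A `1`-cochain is a coboundary on `s`. -/
def IsCoboundaryOn (s : Set P) (c : ∀ i, P → (G i →ₗ[Λ] N)) : Prop :=
  ∃ n : ∀ i, G i →ₗ[Λ] N, ∀ i j (hij : i ≤ j), j ∈ s → ∀ x,
    c i j x = n j (g i j hij x) - n i x

/-- A family of maps out of a directed system is compatible on `s`. -/
def IsCompatibleOn (s : Set P) (u : ∀ i, G i →ₗ[Λ] N) : Prop :=
  ∀ i j (hij : i ≤ j), j ∈ s → ∀ x, u j (g i j hij x) = u i x

end Cocycles

section Modules

variable {Λ : Type u} [Ring Λ]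

/-- `Ext¹`-vanishing gives retractions of extensions of unbundled modules. -/
theorem Ext1Zero.exists_retraction {X Y E : Type u} [AddCommGroup X] [Module Λ X]
    [AddCommGroup Y] [Module Λ Y] [AddCommGroup E] [Module Λ E]
    (h : Ext1Zero (ModuleCat.of Λ X) (ModuleCat.of Λ Y))
    (i : Y →ₗ[Λ] E) (p : E →ₗ[Λ] X) (hi : Function.Injective i) (hp : Function.Surjective p)
    (hip : Function.Exact i p) : ∃ r : E →ₗ[Λ] Y, ∀ y, r (i y) = y := by
  obtain ⟨s, hs⟩ := h (ModuleCat.of Λ E) (ModuleCat.ofHom i) (ModuleCat.ofHom p)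
    (by ext y; exact hip.apply_apply_eq_zero y)
    { exact := (ShortComplex.ShortExact.moduleCat_exact_iff_function_exact _).mpr hip
      mono_f := (ModuleCat.mono_iff_injective _).mpr hi
      epi_g := (ModuleCat.epi_iff_surjective _).mpr hp }
  have hsec : ∃ l : X →ₗ[Λ] E, p ∘ₗ l = LinearMap.id :=
    ⟨s.hom, by
      ext x
      exact congrArg (fun f => f.hom x) hs⟩
  obtain ⟨r, hr⟩ := ((hip.split_tfae hi hp).out 0 1).mp hsec
  exact ⟨r, fun y => LinearMap.congr_fun hr y⟩

/-- `Ext¹`-vanishing gives sections of extensions of unbundled modules. -/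
theorem Ext1Zero.exists_section {X Y E : Type u} [AddCommGroup X] [Module Λ X]
    [AddCommGroup Y] [Module Λ Y] [AddCommGroup E] [Module Λ E]
    (h : Ext1Zero (ModuleCat.of Λ X) (ModuleCat.of Λ Y))
    (i : Y →ₗ[Λ] E) (p : E →ₗ[Λ] X) (hi : Function.Injective i) (hp : Function.Surjective p)
    (hip : Function.Exact i p) : ∃ l : X →ₗ[Λ] E, ∀ x, p (l x) = x := by
  obtain ⟨r, hr⟩ := h.exists_retraction i p hi hp hip
  have hret : ∃ r : E →ₗ[Λ] Y, r ∘ₗ i = LinearMap.id := ⟨r, LinearMap.ext hr⟩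
  obtain ⟨l, hl⟩ := ((hip.split_tfae hi hp).out 0 1).mpr hret
  exact ⟨l, fun x => LinearMap.congr_fun hl x⟩

/-- If `Ext¹(X, M) = 0`, maps from `X` lift along epimorphisms with kernel `M`. -/
theorem Ext1Zero.exists_lift {X M L N : Type u} [AddCommGroup X] [Module Λ X]
    [AddCommGroup M] [Module Λ M] [AddCommGroup L] [Module Λ L] [AddCommGroup N] [Module Λ N]
    (h : Ext1Zero (ModuleCat.of Λ X) (ModuleCat.of Λ M))
    (i : M →ₗ[Λ] L) (p : L →ₗ[Λ] N) (hi : Function.Injective i) (hp : Function.Surjective p)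
    (hip : Function.Exact i p) (f : X →ₗ[Λ] N) : ∃ f' : X →ₗ[Λ] L, ∀ x, p (f' x) = f x := by
  let E : Submodule Λ (X × L) :=
    LinearMap.eqLocus (f ∘ₗ LinearMap.fst Λ X L) (p ∘ₗ LinearMap.snd Λ X L)
  let j : M →ₗ[Λ] E := LinearMap.codRestrict E (LinearMap.inr Λ X L ∘ₗ i) fun m => by
    simp [E, hip.apply_apply_eq_zero]
  obtain ⟨l, hl⟩ := h.exists_section j (LinearMap.fst Λ X L ∘ₗ E.subtype)
    (fun a b hab => hi (congrArg (fun z : E => z.1.2) hab))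
    (fun x => by
      obtain ⟨y, hy⟩ := hp (f x)
      exact ⟨⟨(x, y), hy.symm⟩, rfl⟩)
    (by
      rintro ⟨⟨x, y⟩, hxy⟩
      constructor
      · intro hx
        obtain rfl : x = 0 := hx
        have hy : p y = 0 := by simpa [E] using hxy.symm
        obtain ⟨m, rfl⟩ := (hip y).mp hy
        exact ⟨m, rfl⟩
      · rintro ⟨m, hm⟩
        exact (congrArg (fun z : E => z.1.1) hm).symm)
  refine ⟨LinearMap.snd Λ X L ∘ₗ E.subtype ∘ₗ l, fun x => ?_⟩
  have h1 : f (l x).1.1 = p (l x).1.2 := (l x).2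
  have h2 : (l x).1.1 = x := hl x
  rw [h2] at h1
  exact h1.symm

/-- If `Ext¹(X, L) = 0`, maps into `L` extend along monomorphisms with cokernel `X`. -/
theorem Ext1Zero.exists_extension {X Y E L : Type u} [AddCommGroup X] [Module Λ X]
    [AddCommGroup Y] [Module Λ Y] [AddCommGroup E] [Module Λ E] [AddCommGroup L] [Module Λ L]
    (h : Ext1Zero (ModuleCat.of Λ X) (ModuleCat.of Λ L))
    (i : Y →ₗ[Λ] E) (p : E →ₗ[Λ] X) (hi : Function.Injective i) (hp : Function.Surjective p)
    (hip : Function.Exact i p) (f : Y →ₗ[Λ] L) : ∃ f' : E →ₗ[Λ] L, ∀ y, f' (i y) = f y := by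
  let Q : Submodule Λ (L × E) := LinearMap.range (f.prod (-i))
  let q : (L × E) ⧸ Q →ₗ[Λ] X := Q.liftQ (p ∘ₗ LinearMap.snd Λ L E) (by
    rintro _ ⟨y, rfl⟩
    simp [hip.apply_apply_eq_zero])
  obtain ⟨r, hr⟩ := h.exists_retraction (Q.mkQ ∘ₗ LinearMap.inl Λ L E) q
    (by
      rw [injective_iff_map_eq_zero]
      intro a ha
      obtain ⟨y, hy⟩ := (Submodule.Quotient.mk_eq_zero Q).mp ha
      have h1 : f y = a := congrArg Prod.fst hy
      have h2 : -i y = 0 := congrArg Prod.snd hy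
      have h3 : y = 0 := hi (by rw [map_zero, neg_eq_zero.mp h2])
      rw [← h1, h3, map_zero])
    (fun x => by
      obtain ⟨e, he⟩ := hp x
      exact ⟨Q.mkQ (0, e), he⟩)
    (by
      intro z
      obtain ⟨⟨a, e⟩, rfl⟩ := Q.mkQ_surjective z
      constructor
      · intro hz
        obtain ⟨y, rfl⟩ := (hip e).mp hz
        refine ⟨a + f y, ?_⟩
        rw [← sub_eq_zero, LinearMap.comp_apply, ← map_sub]
        refine (Submodule.Quotient.mk_eq_zero Q).mpr ⟨y, ?_⟩
        simp
      · rintro ⟨b, hb⟩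
        rw [← hb]
        exact map_zero p)
  refine ⟨r ∘ₗ Q.mkQ ∘ₗ LinearMap.inr Λ L E, fun y => ?_⟩
  rw [← hr (f y)]
  refine congrArg r ?_
  rw [← sub_eq_zero, LinearMap.comp_apply, LinearMap.comp_apply, ← map_sub]
  refine (Submodule.Quotient.mk_eq_zero Q).mpr ⟨-y, ?_⟩
  simp

/-- If `Ext¹(lim→ G, N) = 0`, every `N`-valued `1`-cocycle on the system `G` is a coboundary. -/
theorem IsCocycleOn.isCoboundaryOn_univ {J : Type u} [Preorder J] [IsDirectedOrder J] [Nonempty J]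
    [DecidableEq J] {G : J → Type u} [∀ i, AddCommGroup (G i)] [∀ i, Module Λ (G i)]
    (g : ∀ i j, i ≤ j → G i →ₗ[Λ] G j) [hG : DirectedSystem G (g · · ·)]
    {N : Type u} [AddCommGroup N] [Module Λ N]
    (h : Ext1Zero (ModuleCat.of Λ (Module.DirectLimit G g)) (ModuleCat.of Λ N))
    {c : ∀ i, J → (G i →ₗ[Λ] N)} (hc : IsCocycleOn g Set.univ c) :
    IsCoboundaryOn g Set.univ c := by
  let e : ∀ i j, i ≤ j → N × G i →ₗ[Λ] N × G j := fun i j hij =>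
    (LinearMap.fst Λ N (G i) + c i j ∘ₗ LinearMap.snd Λ N (G i)).prod
      (g i j hij ∘ₗ LinearMap.snd Λ N (G i))
  have hself : ∀ i x, g i i le_rfl x = x := fun i x => hG.map_self x
  have hmap : ∀ i j k (hij : i ≤ j) (hjk : j ≤ k) x,
      g j k hjk (g i j hij x) = g i k (hij.trans hjk) x := fun i j k hij hjk x =>
    hG.map_map hij hjk x
  have hc0 : ∀ i x, c i i x = 0 := fun i x => by
    have := hc i i i le_rfl le_rfl trivial x
    rw [hself] at this
    simpa using this
  have he : ∀ i j hij (z : N × G i), e i j hij z = (z.1 + c i j z.2, g i j hij z.2) :=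
    fun _ _ _ _ => rfl
  have : DirectedSystem (fun i => N × G i) (e · · ·) :=
    { map_self := fun i z => by
        rw [he, hc0, hself, add_zero]
      map_map := fun k j i hij hjk z => by
        simp only [he]
        rw [hmap, hc _ _ _ hij hjk trivial, add_assoc] }
  let E := Module.DirectLimit (fun i => N × G i) e
  let π : E →ₗ[Λ] Module.DirectLimit G g :=
    Module.DirectLimit.map (fun i => LinearMap.snd Λ N (G i)) (fun _ _ _ => rfl)
  obtain ⟨j₀⟩ := ‹Nonempty J›
  let ι : N →ₗ[Λ] E := Module.DirectLimit.of Λ J (fun i => N × G i) e j₀ ∘ₗ LinearMap.inl Λ N _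
  have hι : ∀ j a, Module.DirectLimit.of Λ J (fun i => N × G i) e j (a, 0) = ι a := by
    intro j a
    obtain ⟨k, hjk, h0k⟩ := exists_ge_ge j j₀
    have h1 : ∀ j (hj : j ≤ k), Module.DirectLimit.of Λ J (fun i => N × G i) e j (a, 0) =
        Module.DirectLimit.of Λ J (fun i => N × G i) e k (a, 0) := fun j hj => by
      rw [← Module.DirectLimit.of_f (hij := hj), he]
      simp
    exact (h1 j hjk).trans (h1 j₀ h0k).symm
  have hπ : ∀ j z, π (Module.DirectLimit.of Λ J (fun i => N × G i) e j z) =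
      Module.DirectLimit.of Λ J G g j z.2 := fun j z => Module.DirectLimit.map_apply_of _ _ _
  obtain ⟨r, hr⟩ := h.exists_retraction ι π
    (by
      rw [injective_iff_map_eq_zero]
      intro a ha
      obtain ⟨k, hk, hz⟩ := Module.DirectLimit.of.zero_exact ha
      have := congrArg Prod.fst hz
      simpa [he] using this)
    (fun x => by
      obtain ⟨j, y, rfl⟩ := Module.DirectLimit.exists_of x
      exact ⟨_, hπ j (0, y)⟩)
    (by
      intro z
      obtain ⟨j, ⟨a, x⟩, rfl⟩ := Module.DirectLimit.exists_of z
      constructor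
      · intro hz
        rw [hπ] at hz
        obtain ⟨k, hk, hx⟩ := Module.DirectLimit.of.zero_exact hz
        refine ⟨a + c j k x, ?_⟩
        rw [← Module.DirectLimit.of_f (hij := hk), he, ← hι k]
        exact congrArg _ (Prod.ext rfl hx.symm)
      · rintro ⟨b, hb⟩
        rw [← hb]
        exact (hπ j₀ (b, 0)).trans (map_zero _))
  refine ⟨fun j => -(r ∘ₗ Module.DirectLimit.of Λ J (fun i => N × G i) e j ∘ₗ
    LinearMap.inr Λ N (G j)), fun i j hij _ x => ?_⟩
  have h1 : Module.DirectLimit.of Λ J (fun i => N × G i) e i (0, x) =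
      ι (c i j x) + Module.DirectLimit.of Λ J (fun i => N × G i) e j (0, g i j hij x) := by
    rw [← hι j, ← map_add, ← Module.DirectLimit.of_f (hij := hij), he]
    simp
  have h2 := congrArg r h1
  rw [map_add, hr] at h2
  simp [h2]

end Modules

section Lifting

variable {Λ : Type*} [Ring Λ] {M L N : Type*} [AddCommGroup M] [Module Λ M]
  [AddCommGroup L] [Module Λ L] [AddCommGroup N] [Module Λ N]
  {ι : M →ₗ[Λ] L} {p : L →ₗ[Λ] N}

/-- Maps killed by `p` factor through the kernel `ι` of `p`. -/
theorem exists_factor_of_exact (hι : Function.Injective ι) (hιp : Function.Exact ι p)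
    {X : Type*} [AddCommGroup X] [Module Λ X] (f : X →ₗ[Λ] L) (hf : ∀ x, p (f x) = 0) :
    ∃ h : X →ₗ[Λ] M, ∀ x, ι (h x) = f x := by
  let f' : X →ₗ[Λ] LinearMap.range ι := f.codRestrict _ fun x => (hιp (f x)).mp (hf x)
  refine ⟨(LinearEquiv.ofInjective ι hι).symm.toLinearMap ∘ₗ f', fun x => ?_⟩
  have := (LinearEquiv.ofInjective ι hι).apply_symm_apply (f' x)
  exact congrArg Subtype.val this

variable {P : Type*} [Preorder P] {G : P → Type*} [∀ i, AddCommGroup (G i)]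
  [∀ i, Module Λ (G i)] {g : ∀ i j, i ≤ j → G i →ₗ[Λ] G j}

/-- If `M`-valued cocycles on `s` are coboundaries, then termwise liftable compatible families
of maps into `N` lift to compatible families of maps into `L`. -/
theorem IsCompatibleOn.exists_lift
    (hmap : ∀ i j k (hij : i ≤ j) (hjk : j ≤ k) x,
      g j k hjk (g i j hij x) = g i k (hij.trans hjk) x)
    (hι : Function.Injective ι) (hιp : Function.Exact ι p)
    (hlift : ∀ i (u : G i →ₗ[Λ] N), ∃ v : G i →ₗ[Λ] L, ∀ x, p (v x) = u x)
    {s : Set P} (hs : IsLowerSet s)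
    (hsM : ∀ c : ∀ i, P → (G i →ₗ[Λ] M), IsCocycleOn g s c → IsCoboundaryOn g s c)
    {u : ∀ i, G i →ₗ[Λ] N} (hu : IsCompatibleOn g s u) :
    ∃ v : ∀ i, G i →ₗ[Λ] L, (∀ i x, p (v i x) = u i x) ∧ IsCompatibleOn g s v := by
  choose v hv using fun i => hlift i (u i)
  have hex : ∀ i j, ∃ h : G i →ₗ[Λ] M, ∀ (hij : i ≤ j), j ∈ s → ∀ x,
      ι (h x) = v j (g i j hij x) - v i x := by
    intro i j
    by_cases hij : i ≤ j ∧ j ∈ s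
    · obtain ⟨h, hh⟩ := exists_factor_of_exact hι hιp (v j ∘ₗ g i j hij.1 - v i) fun x => by
        simp [hv, hu i j hij.1 hij.2]
      exact ⟨h, fun _ _ x => hh x⟩
    · exact ⟨0, fun h1 h2 => (hij ⟨h1, h2⟩).elim⟩
  choose c hc using hex
  obtain ⟨n, hn⟩ := hsM c fun i j k hij hjk hk x => hι (by
    rw [map_add, hc i k (hij.trans hjk) hk, hc i j hij (hs hjk hk), hc j k hjk hk, hmap]
    abel)
  refine ⟨fun i => v i - ι ∘ₗ n i, fun i x => ?_, fun i j hij hj x => ?_⟩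
  · simp [hv, hιp.apply_apply_eq_zero]
  · have h1 := hc i j hij hj x
    rw [hn i j hij hj, map_sub] at h1
    simp only [LinearMap.sub_apply, LinearMap.comp_apply]
    rw [sub_eq_sub_iff_sub_eq_sub, ← h1]

/-- An `L`-valued cocycle on `s` lifting an `M`-valued cocycle on a larger set `t` extends
to a lift on `t`. -/
theorem IsCocycleOn.exists_extension {p : L →ₗ[Λ] M}
    (hmap : ∀ i j k (hij : i ≤ j) (hjk : j ≤ k) x,
      g j k hjk (g i j hij x) = g i k (hij.trans hjk) x)
    (hι : Function.Injective ι) (hιp : Function.Exact ι p)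
    (hlift : ∀ i (u : G i →ₗ[Λ] M), ∃ v : G i →ₗ[Λ] L, ∀ x, p (v x) = u x)
    {s t : Set P} (hs : IsLowerSet s) (hst : s ⊆ t)
    (hsM : ∀ c : ∀ i, P → (G i →ₗ[Λ] M), IsCocycleOn g s c → IsCoboundaryOn g s c)
    (htM : ∀ c : ∀ i, P → (G i →ₗ[Λ] M), IsCocycleOn g t c → IsCoboundaryOn g t c)
    (hsL : ∀ c : ∀ i, P → (G i →ₗ[Λ] L), IsCocycleOn g s c → IsCoboundaryOn g s c)
    {c : ∀ i, P → (G i →ₗ[Λ] M)} (hc : IsCocycleOn g t c)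
    {m : ∀ i, P → (G i →ₗ[Λ] L)} (hm : IsCocycleOn g s m)
    (hmc : ∀ i j, i ≤ j → j ∈ s → ∀ x, p (m i j x) = c i j x) :
    ∃ m' : ∀ i, P → (G i →ₗ[Λ] L), IsCocycleOn g t m' ∧
      (∀ i j, i ≤ j → j ∈ t → ∀ x, p (m' i j x) = c i j x) ∧
      ∀ i j, i ≤ j → j ∈ s → m' i j = m i j := by
  classical
  obtain ⟨n, hn⟩ := hsL m hm
  obtain ⟨k, hk⟩ := htM c hc
  obtain ⟨w, hpw, hw⟩ := IsCompatibleOn.exists_lift hmap hι hιp hlift hs hsM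
    (u := fun i => p ∘ₗ n i - k i) (fun i j hij hj x => by
      have h1 := hmc i j hij hj x
      rw [hn i j hij hj, hk i j hij (hst hj), map_sub] at h1
      simp only [LinearMap.sub_apply, LinearMap.comp_apply]
      rw [sub_eq_sub_iff_sub_eq_sub, h1])
  let m' : ∀ i, P → (G i →ₗ[Λ] L) := fun i j =>
    if hij : i ≤ j then (n j - w j) ∘ₗ g i j hij - (n i - w i) else 0
  have hm' : ∀ i j (hij : i ≤ j) x,
      m' i j x = (n j (g i j hij x) - w j (g i j hij x)) - (n i x - w i x) := fun i j hij x => by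
    simp [m', hij]
  refine ⟨m', fun i j l hij hjl hl x => ?_, fun i j hij hj x => ?_, fun i j hij hj => ?_⟩
  · rw [hm' i l (hij.trans hjl), hm' i j hij, hm' j l hjl, hmap]
    abel
  · rw [hm' i j hij, hk i j hij hj]
    simp [hpw]
  · ext x
    rw [hm' i j hij, hn i j hij hj, hw i j hij hj]
    abel

end Lifting

section Induction

open Cardinal

/-- The finite subsets of a given set. -/
def finsetsBelow {I : Type*} (Z : Set I) : Set (Finset I) := {T | (T : Set I) ⊆ Z}

theorem isLowerSet_finsetsBelow {I : Type*} (Z : Set I) : IsLowerSet (finsetsBelow Z) :=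
  fun _ _ h hT => (Finset.coe_subset.mpr h).trans hT

variable {Λ : Type*} [Ring Λ] {M L : Type*} [AddCommGroup M] [Module Λ M]
  [AddCommGroup L] [Module Λ L] {ι : M →ₗ[Λ] L} {p : L →ₗ[Λ] M}
  {I : Type u} {G : Finset I → Type*} [∀ i, AddCommGroup (G i)]
  [∀ i, Module Λ (G i)] {g : ∀ i j, i ≤ j → G i →ₗ[Λ] G j}

/-- If the `M`-valued cocycle `c` is a coboundary on the finite subsets of every set of smaller
cardinality than the infinite set `Z`, then `c` lifts to an `L`-valued cocycle on the finite
subsets of `Z`. -/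
theorem IsCocycleOn.exists_lift_of_infinite
    (hself : ∀ i x, g i i le_rfl x = x)
    (hmap : ∀ i j k (hij : i ≤ j) (hjk : j ≤ k) x,
      g j k hjk (g i j hij x) = g i k (hij.trans hjk) x)
    (hι : Function.Injective ι) (hιp : Function.Exact ι p)
    (hlift : ∀ i (u : G i →ₗ[Λ] M), ∃ v : G i →ₗ[Λ] L, ∀ x, p (v x) = u x)
    (hL : ∀ (Z : Set I) (c : ∀ i, Finset I → (G i →ₗ[Λ] L)),
      IsCocycleOn g (finsetsBelow Z) c → IsCoboundaryOn g (finsetsBelow Z) c)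
    {Z : Set I} (hZ : Z.Infinite)
    (ih : ∀ Y : Set I, #Y < #Z → ∀ c : ∀ i, Finset I → (G i →ₗ[Λ] M),
      IsCocycleOn g (finsetsBelow Y) c → IsCoboundaryOn g (finsetsBelow Y) c)
    {c : ∀ i, Finset I → (G i →ₗ[Λ] M)} (hc : IsCocycleOn g (finsetsBelow Z) c) :
    ∃ m : ∀ i, Finset I → (G i →ₗ[Λ] L), IsCocycleOn g (finsetsBelow Z) m ∧
      ∀ i j, i ≤ j → j ∈ finsetsBelow Z → ∀ x, p (m i j x) = c i j x := by
  classical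
  obtain ⟨e⟩ : Nonempty ((#Z).ord.ToType ≃ Z) := Cardinal.eq.mp (Cardinal.mk_ord_toType _)
  let φ : (#Z).ord.ToType → I := fun a => e a
  have hφZ : ∀ W : Set (#Z).ord.ToType, φ '' W ⊆ Z := by
    rintro W _ ⟨a, _, rfl⟩
    exact (e a).2
  have hφuniv : φ '' Set.univ = Z :=
    (hφZ _).antisymm fun z hz => ⟨e.symm ⟨z, hz⟩, trivial, by simp [φ]⟩
  let Good : Set (#Z).ord.ToType × (∀ i, Finset I → (G i →ₗ[Λ] L)) → Prop := fun q =>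
    IsLowerSet q.1 ∧ IsCocycleOn g (finsetsBelow (φ '' q.1)) q.2 ∧
      ∀ i j, i ≤ j → j ∈ finsetsBelow (φ '' q.1) → ∀ x, p (q.2 i j x) = c i j x
  let r : {q // Good q} → {q // Good q} → Prop := fun a b =>
    a.1.1 ⊆ b.1.1 ∧ ∀ i j, i ≤ j → j ∈ finsetsBelow (φ '' a.1.1) → b.1.2 i j = a.1.2 i j
  have hbelow : ∀ {W W' : Set (#Z).ord.ToType}, W ⊆ W' →
      finsetsBelow (φ '' W) ⊆ finsetsBelow (φ '' W') := fun h T hT =>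
    hT.trans (Set.image_mono h)
  have hcW : ∀ W : Set (#Z).ord.ToType, IsCocycleOn g (finsetsBelow (φ '' W)) c :=
    fun W i j k hij hjk hk => hc i j k hij hjk (hk.trans (hφZ W))
  have hchain : ∀ C : Set {q // Good q}, IsChain r C → C.Nonempty → ∃ ub, ∀ a ∈ C, r a ub := by
    intro C hC hne
    let W : Set (#Z).ord.ToType := ⋃ a ∈ C, a.1.1
    have hdir : DirectedOn (fun a b : {q // Good q} => φ '' a.1.1 ⊆ φ '' b.1.1) C := by
      intro a ha b hb
      by_cases hab : a = b
      · exact ⟨a, ha, subset_rfl, hab ▸ subset_rfl⟩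
      rcases hC ha hb hab with h | h
      · exact ⟨b, hb, Set.image_mono h.1, subset_rfl⟩
      · exact ⟨a, ha, subset_rfl, Set.image_mono h.1⟩
    have hmem : ∀ T ∈ finsetsBelow (φ '' W), ∃ a ∈ C, T ∈ finsetsBelow (φ '' a.1.1) := by
      intro T hT
      refine DirectedOn.exists_mem_subset_of_finset_subset_biUnion hne hdir ?_
      simpa only [W, Set.image_iUnion] using (show (T : Set I) ⊆ φ '' W from hT)
    let m : ∀ i, Finset I → (G i →ₗ[Λ] L) := fun i j =>
      if h : ∃ a ∈ C, j ∈ finsetsBelow (φ '' a.1.1) then h.choose.1.2 i j else 0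
    have hm : ∀ a ∈ C, ∀ i j, i ≤ j → j ∈ finsetsBelow (φ '' a.1.1) →
        m i j = a.1.2 i j := by
      intro a ha i j hij hj
      have h : ∃ a ∈ C, j ∈ finsetsBelow (φ '' a.1.1) := ⟨a, ha, hj⟩
      have h1 : m i j = h.choose.1.2 i j := dif_pos h
      rw [h1]
      obtain ⟨hbC, hbj⟩ := h.choose_spec
      by_cases hab : h.choose = a
      · rw [hab]
      rcases hC hbC ha hab with h | h
      · exact (h.2 i j hij hbj).symm
      · exact h.2 i j hij hj
    refine ⟨⟨(W, m), ?_, ?_, ?_⟩, fun a ha =>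
      ⟨Set.subset_biUnion_of_mem (u := fun a : {q // Good q} => a.1.1) ha, hm a ha⟩⟩
    · exact isLowerSet_iUnion₂ fun a _ => a.2.1
    · intro i j k hij hjk hk x
      obtain ⟨a, ha, hka⟩ := hmem k hk
      change m i k x = m i j x + m j k _
      rw [hm a ha i k (hij.trans hjk) hka, hm a ha j k hjk hka,
        hm a ha i j hij (isLowerSet_finsetsBelow _ hjk hka)]
      exact a.2.2.1 i j k hij hjk hka x
    · intro i j hij hj x
      obtain ⟨a, ha, hja⟩ := hmem j hj
      change p (m i j x) = _
      rw [hm a ha i j hij hja]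
      exact a.2.2.2 i j hij hja x
  have hempty : ∀ {T : Finset I}, T ∈ finsetsBelow (φ '' (∅ : Set (#Z).ord.ToType)) → T = ∅ :=
    fun hT => by simpa [finsetsBelow] using hT
  have hbase : Good (∅, fun _ _ => 0) := by
    refine ⟨isLowerSet_empty, fun _ _ _ _ _ _ _ => by simp, fun i j hij hj x => ?_⟩
    obtain rfl := hempty hj
    obtain rfl : i = ∅ := Finset.subset_empty.mp hij
    have h1 := hc ∅ ∅ ∅ le_rfl le_rfl (fun z hz => by simp at hz) x
    rw [hself, left_eq_add] at h1
    simp [h1]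
  have : Nonempty {q // Good q} := ⟨⟨_, hbase⟩⟩
  obtain ⟨⟨⟨W, m⟩, hW, hmW, hmc⟩, hmax⟩ := exists_maximal_of_nonempty_chains_bounded hchain
    (fun {a b d} hab hbd => ⟨hab.1.trans hbd.1, fun i j hij hj =>
      (hbd.2 i j hij (hbelow hab.1 hj)).trans (hab.2 i j hij hj)⟩)
  suffices hWuniv : W = Set.univ by
    subst hWuniv
    rw [← hφuniv]
    exact ⟨m, hmW, hmc⟩
  by_contra hWne
  obtain ⟨a, haW, hamin⟩ := WellFounded.has_min (wellFounded_lt (α := (#Z).ord.ToType)) Wᶜ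
    (Set.nonempty_compl.mpr hWne)
  have hWIio : W ⊆ Set.Iio a := fun b hb => lt_of_not_ge fun hab => haW (hW hab hb)
  have hIcc : Set.Iio a ⊆ W := fun b hb => by_contra fun hbW => hamin b hbW hb
  obtain rfl : W = Set.Iio a := hWIio.antisymm hIcc
  have hcard : ∀ V : Set (#Z).ord.ToType, #V < #Z → #(φ '' V) < #Z := fun V hV =>
    lt_of_le_of_lt Cardinal.mk_image_le hV
  have hIio : #(Set.Iio a) < #Z := by
    simpa using Cardinal.mk_Iio_lt a (by simp)
  have hZinf : ℵ₀ ≤ #Z := Cardinal.infinite_iff.mp hZ.to_subtype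
  have hIic : #(Set.Iic a) < #Z := by
    rw [← Set.Iio_insert]
    exact lt_of_le_of_lt (Cardinal.mk_insert_le) (Cardinal.add_lt_of_lt hZinf hIio
      (Cardinal.one_lt_aleph0.trans_le hZinf))
  obtain ⟨m', hm', hm'c, hm'm⟩ := IsCocycleOn.exists_extension hmap hι hιp hlift
    (isLowerSet_finsetsBelow _) (hbelow Set.Iio_subset_Iic_self)
    (ih _ (hcard _ hIio)) (ih _ (hcard _ hIic)) (hL _) (hcW (Set.Iic a)) hmW hmc
  have := hmax ⟨(Set.Iic a, m'), isLowerSet_Iic a, hm', hm'c⟩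
    ⟨Set.Iio_subset_Iic_self, hm'm⟩
  exact lt_irrefl a (this.1 (Set.mem_Iic.mpr le_rfl))

/-- `M`-valued cocycles are coboundaries on the finite subsets of every set. -/
theorem isCoboundaryOn_finsetsBelow
    (hself : ∀ i x, g i i le_rfl x = x)
    (hmap : ∀ i j k (hij : i ≤ j) (hjk : j ≤ k) x,
      g j k hjk (g i j hij x) = g i k (hij.trans hjk) x)
    (hι : Function.Injective ι) (hιp : Function.Exact ι p)
    (hlift : ∀ i (u : G i →ₗ[Λ] M), ∃ v : G i →ₗ[Λ] L, ∀ x, p (v x) = u x)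
    (hL : ∀ (Z : Set I) (c : ∀ i, Finset I → (G i →ₗ[Λ] L)),
      IsCocycleOn g (finsetsBelow Z) c → IsCoboundaryOn g (finsetsBelow Z) c)
    (Z : Set I) (c : ∀ i, Finset I → (G i →ₗ[Λ] M))
    (hc : IsCocycleOn g (finsetsBelow Z) c) : IsCoboundaryOn g (finsetsBelow Z) c := by
  classical
  induction hκ : #Z using WellFoundedLT.induction generalizing Z c with
  | ind κ ih =>
    subst hκ
    rcases Z.finite_or_infinite with hZ | hZ
    · have htop : hZ.toFinset ∈ finsetsBelow Z := fun z hz => by simpa using hz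
      have hle : ∀ j ∈ finsetsBelow Z, j ≤ hZ.toFinset := fun j hj z hz => by
        simpa using hj hz
      refine ⟨fun i => -c i hZ.toFinset, fun i j hij hj x => ?_⟩
      rw [LinearMap.neg_apply, LinearMap.neg_apply, hc i j _ hij (hle j hj) htop]
      abel
    · obtain ⟨m, hm, hmc⟩ := hc.exists_lift_of_infinite hself hmap hι hιp hlift hL hZ
        fun Y hY c' hc' => ih _ hY Y c' hc' rfl
      obtain ⟨n, hn⟩ := hL Z m hm
      refine ⟨fun i => p ∘ₗ n i, fun i j hij hj x => ?_⟩
      rw [← hmc i j hij hj, hn i j hij hj, map_sub]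
      rfl

end Induction

/-- There is a monotone cofinal map to a nonempty directed poset from a poset of finite sets. -/
theorem exists_monotone_finset {I : Type*} [PartialOrder I] [IsDirectedOrder I] [Nonempty I] :
    ∃ φ : Finset I → I, Monotone φ ∧ ∀ x, x ≤ φ {x} := by
  classical
  choose ub hub using fun T : Finset I => Finset.exists_le T
  let φ : Finset I → I := Finset.strongInduction fun T ih =>
    ub (T ∪ T.ssubsets.attach.image fun V => ih V.1 (Finset.mem_ssubsets.mp V.2))
  have hφ : ∀ T, φ T = ub (T ∪ T.ssubsets.attach.image fun V => φ V.1) := fun T =>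
    Finset.strongInduction_eq _ _
  refine ⟨φ, fun V T hVT => ?_, fun x => ?_⟩
  · rcases hVT.eq_or_ssubset with rfl | h
    · exact le_rfl
    rw [hφ T]
    refine hub _ _ (Finset.mem_union_right _ (Finset.mem_image.mpr
      ⟨⟨V, Finset.mem_ssubsets.mpr h⟩, Finset.mem_attach _ _, rfl⟩))
  · rw [hφ]
    exact hub _ _ (Finset.mem_union_left _ (Finset.mem_singleton_self x))

/-- Periodicity, in the form of a lifting property: maps from a direct limit of modules of `S`
to `M` lift along `L → M`. -/
theorem exists_lift_of_mem_limClosure {Λ : Type u} [Ring Λ] {S : Set (ModuleCat.{u} Λ)}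
    {M L A : ModuleCat.{u} Λ} (hM : M ∈ rightPerp S) (hL : L ∈ rightPerp (limClosure S))
    (hA : A ∈ limClosure S) {ι : M →ₗ[Λ] L} {p : L →ₗ[Λ] M} (hι : Function.Injective ι)
    (hp : Function.Surjective p) (hιp : Function.Exact ι p) (f : A →ₗ[Λ] M) :
    ∃ f' : A →ₗ[Λ] L, ∀ a, p (f' a) = f a := by
  classical
  obtain ⟨I, dir, ne, F, hFS, c, hc, e⟩ := hA
  obtain ⟨φ, hφ, hφx⟩ := exists_monotone_finset (I := I)
  let g : ∀ i j, i ≤ j → F.obj (φ i) →ₗ[Λ] F.obj (φ j) := fun i j hij =>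
    (F.map (homOfLE (hφ hij))).hom
  have hself : ∀ i x, g i i le_rfl x = x := fun i x => by
    change (F.map (𝟙 (φ i))).hom x = x
    rw [F.map_id]
    rfl
  have hmap : ∀ i j k (hij : i ≤ j) (hjk : j ≤ k) x,
      g j k hjk (g i j hij x) = g i k (hij.trans hjk) x := fun i j k hij hjk x => by
    change _ = (F.map (homOfLE (hφ hij) ≫ homOfLE (hφ hjk))).hom x
    rw [F.map_comp]
    rfl
  have hLtriv : ∀ (Z : Set I) (c : ∀ i, Finset I → (F.obj (φ i) →ₗ[Λ] L)),
      IsCocycleOn g (finsetsBelow Z) c → IsCoboundaryOn g (finsetsBelow Z) c := by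
    intro Z c hc
    let J := {T : Finset I // T ∈ finsetsBelow Z}
    let gJ : ∀ i j : J, i ≤ j → F.obj (φ i.1) →ₗ[Λ] F.obj (φ j.1) := fun i j hij => g i.1 j.1 hij
    have hdirJ : IsDirectedOrder J := ⟨fun a b => ⟨⟨a.1 ∪ b.1, by
      have ha : (a.1 : Set I) ⊆ Z := a.2
      have hb : (b.1 : Set I) ⊆ Z := b.2
      change ((a.1 ∪ b.1 : Finset I) : Set I) ⊆ Z
      rw [Finset.coe_union]
      exact Set.union_subset ha hb⟩,
      Finset.subset_union_left (s₁ := a.1), Finset.subset_union_right (s₂ := b.1)⟩⟩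
    have hneJ : Nonempty J := ⟨⟨∅, fun z hz => by simp at hz⟩⟩
    have hsys : DirectedSystem (fun i : J => F.obj (φ i.1)) (gJ · · ·) :=
      { map_self := fun i x => hself i.1 x
        map_map := fun k j i hij hjk x => hmap i.1 j.1 k.1 hij hjk x }
    have hmem : ModuleCat.of Λ (Module.DirectLimit (fun i : J => F.obj (φ i.1)) gJ) ∈
        limClosure S :=
      ⟨{ I := J
         dir := hdirJ
         ne := hneJ
         F := ModuleCat.directLimitDiagram (fun i : J => F.obj (φ i.1)) gJ
         mem := fun i => hFS (φ i.1)
         c := ModuleCat.directLimitCocone _ gJ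
         hc := ModuleCat.directLimitIsColimit _ gJ
         iso := Iso.refl _ }⟩
    obtain ⟨n, hn⟩ := IsCocycleOn.isCoboundaryOn_univ gJ (hL _ hmem)
      (c := fun i j => c i.1 j.1) fun i j k hij hjk _ x => hc i.1 j.1 k.1 hij hjk k.2 x
    refine ⟨fun T => if hT : T ∈ finsetsBelow Z then n ⟨T, hT⟩ else 0, fun i j hij hj x => ?_⟩
    have hi := isLowerSet_finsetsBelow Z hij hj
    simp only [dif_pos hi, dif_pos hj]
    exact hn ⟨i, hi⟩ ⟨j, hj⟩ hij trivial x
  have hlift : ∀ i (u : F.obj (φ i) →ₗ[Λ] M), ∃ v : F.obj (φ i) →ₗ[Λ] L, ∀ x, p (v x) = u x :=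
    fun i u => (hM _ (hFS (φ i))).exists_lift ι p hι hp hιp u
  have hnat : ∀ i j (h : i ≤ j) x, (c.ι.app j).hom ((F.map (homOfLE h)).hom x) =
      (c.ι.app i).hom x := fun i j h x =>
    congrArg (fun q => q.hom x) (c.w (homOfLE h))
  obtain ⟨v, hv, hvc⟩ := IsCompatibleOn.exists_lift hmap hι hιp hlift
    (isLowerSet_finsetsBelow Set.univ)
    (isCoboundaryOn_finsetsBelow hself hmap hι hιp hlift hLtriv Set.univ)
    (u := fun T => f ∘ₗ e.hom.hom ∘ₗ (c.ι.app (φ T)).hom)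
    (fun i j hij _ x => congrArg (fun y => f (e.hom.hom y)) (hnat _ _ (hφ hij) x))
  have hvc' : ∀ i j (hij : i ≤ j) x, v j (g i j hij x) = v i x := fun i j hij x =>
    hvc i j hij (Set.subset_univ _) x
  let s : Cocone F :=
    { pt := L
      ι :=
        { app := fun x => F.map (homOfLE (hφx x)) ≫ ModuleCat.ofHom (v {x})
          naturality := fun x y hxy => by
            ext a
            have hx := hvc' {x} {x, y} (by simp) ((F.map (homOfLE (hφx x))).hom a)
            have hy := hvc' {y} {x, y} (by simp)
              ((F.map (homOfLE (hφx y))).hom ((F.map hxy).hom a))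
            have hxy' : g {y} {x, y} (by simp) ((F.map (homOfLE (hφx y))).hom ((F.map hxy).hom a)) =
                g {x} {x, y} (by simp) ((F.map (homOfLE (hφx x))).hom a) := by
              change (F.map hxy ≫ F.map (homOfLE (hφx y)) ≫ F.map (homOfLE _)).hom a =
                (F.map (homOfLE (hφx x)) ≫ F.map (homOfLE _)).hom a
              rw [← F.map_comp, ← F.map_comp, ← F.map_comp]
              rfl
            rw [hxy', hx] at hy
            exact hy.symm } }
  refine ⟨(e.inv ≫ hc.desc s).hom, fun a => ?_⟩
  have key : hc.desc s ≫ ModuleCat.ofHom p = e.hom ≫ ModuleCat.ofHom f := by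
    refine hc.hom_ext fun x => ?_
    rw [hc.fac_assoc]
    ext a
    change p (v {x} _) = _
    rw [hv]
    exact congrArg (fun y => f (e.hom.hom y)) (hnat _ _ (hφx x) a)
  have := congrArg (fun q => (e.inv ≫ q).hom a) key
  rw [Iso.inv_hom_id_assoc] at this
  exact this

theorem statement4 {R : Type u} [Ring R] (S : Set (ModuleCat.{u} Rᵐᵒᵖ))
    (hsfp : ∀ M ∈ S, StronglyFinitelyPresented M)
    (hfree : ModuleCat.of Rᵐᵒᵖ Rᵐᵒᵖ ∈ S)
    (hsummands : ClosedUnderDirectSummands S)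
    (hext : ClosedUnderExtensions S)
    (hker : ClosedUnderKernelsOfEpis S)
    (B C D : Set (ModuleCat.{u} Rᵐᵒᵖ))
    (hB : B = rightPerp S) (hC : C = limClosure S) (hD : D = rightPerp C)
    (M L : ModuleCat.{u} Rᵐᵒᵖ) (i : M ⟶ L) (p : L ⟶ M) (w : i ≫ p = 0)
    (hse : (ShortComplex.mk i p w).ShortExact)
    (hL : L ∈ D) (hM : M ∈ B) :
    M ∈ D := by
  subst hB hC hD
  intro A hA E j q wE hE
  have hi := hse.moduleCat_injective_f
  have hp := hse.moduleCat_surjective_g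
  have hip := (ShortComplex.ShortExact.moduleCat_exact_iff_function_exact _).mp hse.exact
  have hj := hE.moduleCat_injective_f
  have hq := hE.moduleCat_surjective_g
  have hjq := (ShortComplex.ShortExact.moduleCat_exact_iff_function_exact _).mp hE.exact
  dsimp only at hi hp hip hj hq hjq
  obtain ⟨t, ht⟩ := Ext1Zero.exists_extension (hL A hA) j.hom q.hom hj hq hjq i.hom
  obtain ⟨f, hf⟩ : ∃ f : A →ₗ[Rᵐᵒᵖ] M, ∀ x, f (q.hom x) = p.hom (t x) := by
    have hker : LinearMap.ker q.hom ≤ LinearMap.ker (p.hom ∘ₗ t) := fun x hx => by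
      obtain ⟨y, rfl⟩ := (hjq x).mp hx
      change p.hom (t (j.hom y)) = 0
      rw [ht]
      exact hip.apply_apply_eq_zero y
    refine ⟨(LinearMap.ker q.hom).liftQ (p.hom ∘ₗ t) hker ∘ₗ
      (q.hom.quotKerEquivOfSurjective hq).symm.toLinearMap, fun x => ?_⟩
    have hx : (q.hom.quotKerEquivOfSurjective hq).symm (q.hom x) = Submodule.Quotient.mk x := by
      rw [LinearEquiv.symm_apply_eq]
      rfl
    simp only [LinearMap.comp_apply, LinearEquiv.coe_coe, hx]
    rfl
  obtain ⟨f', hf'⟩ := exists_lift_of_mem_limClosure hM hL hA hi hp hip f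
  obtain ⟨r, hr⟩ := exists_factor_of_exact hi hip (t - f' ∘ₗ q.hom) fun x => by
    simp only [LinearMap.sub_apply, LinearMap.comp_apply, map_sub]
    rw [hf', hf, sub_self]
  have hret : ∃ r : E →ₗ[Rᵐᵒᵖ] M, r ∘ₗ j.hom = LinearMap.id := by
    refine ⟨r, LinearMap.ext fun y => hi ?_⟩
    change i.hom (r (j.hom y)) = i.hom y
    rw [hr, LinearMap.sub_apply, ht, LinearMap.comp_apply, hjq.apply_apply_eq_zero, map_zero,
      sub_zero]
  obtain ⟨l, hl⟩ := ((hjq.split_tfae hj hq).out 0 1).mpr hret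
  exact ⟨ModuleCat.ofHom l, by
    ext x
    exact LinearMap.congr_fun hl x⟩

end GenPeriodicity
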